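/- arXiv:math/0608673 — 2 statements merged into one kernel-verified Lean document; each statement's English description precedes it below -/
import Mathlib

section
/- For every k ≥ 0, the map D ↦ D* is a linear isomorphism from Hom(H, H^{⊗(k+1)}) onto H^{⊗(k+2)}, and it restricts to a linear isomorphism from 𝔞_g(k) onto the subspace of H^{⊗(k+2)} of tensors fixed by the cyclic permutation σ_{k+2} (the ℤ/(k+2)ℤ-invariant part). -/
/- Coordinate model of the symplectic vector space `H = ℚ^{2g}` and its tensor powers.
`I g` indexes the symplectic basis `x_1, …, x_g, y_1, …, y_g`;
`T g m` is the coordinate model of `H^{⊗ m}` (coordinates w.r.t. the basis tensors). -/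

abbrev I (g : ℕ) := Fin g ⊕ Fin g
abbrev H (g : ℕ) := I g → ℚ
abbrev T (g m : ℕ) := (Fin m → I g) → ℚ

/-- the basis vector `x_i` -/
def xB (g : ℕ) (i : Fin g) : H g := Pi.single (Sum.inl i) 1
/-- the basis vector `y_i` -/
def yB (g : ℕ) (i : Fin g) : H g := Pi.single (Sum.inr i) 1

/-- the symplectic intersection pairing `u · v` -/
def pairH (g : ℕ) (u v : H g) : ℚ :=
  ∑ i : Fin g, (u (Sum.inl i) * v (Sum.inr i) - u (Sum.inr i) * v (Sum.inl i))

/-- `D(ω₀) = (D ⊗ id + id ⊗ D)(ω₀)` for `ω₀ = Σᵢ (xᵢ ⊗ yᵢ - yᵢ ⊗ xᵢ)`. -/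
def Dom (g k : ℕ) (D : H g →ₗ[ℚ] T g (k+1)) : T g (k+2) := fun φ =>
  ∑ i : Fin g,
    (D (xB g i) (fun p => φ p.castSucc) * yB g i (φ (Fin.last (k+1)))
      + xB g i (φ 0) * D (yB g i) (fun p => φ p.succ)
      - D (yB g i) (fun p => φ p.castSucc) * xB g i (φ (Fin.last (k+1)))
      - yB g i (φ 0) * D (xB g i) (fun p => φ p.succ))

/-- `D* = Σᵢ (xᵢ ⊗ D(yᵢ) - yᵢ ⊗ D(xᵢ))`. -/
def dstar (g k : ℕ) (D : H g →ₗ[ℚ] T g (k+1)) : T g (k+2) := fun φ =>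
  ∑ i : Fin g,
    (xB g i (φ 0) * D (yB g i) (fun p => φ p.succ)
      - yB g i (φ 0) * D (xB g i) (fun p => φ p.succ))

/-- the cyclic permutation `σ_m : u₁ ⊗ ⋯ ⊗ u_m ↦ u₂ ⊗ ⋯ ⊗ u_m ⊗ u₁`. -/
def cyc (g m : ℕ) (t : T g m) : T g m := fun φ => t (φ ∘ (finRotate m).symm)

theorem dstar_apply (g k : ℕ) (D : H g →ₗ[ℚ] T g (k+1)) (φ : Fin (k+2) → I g) :
    dstar g k D φ = Sum.elim (fun i => D (yB g i) (fun p => φ p.succ))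
      (fun i => - D (xB g i) (fun p => φ p.succ)) (φ 0) := by
  unfold dstar
  rcases h : φ 0 with j | j <;> simp [xB, yB, Pi.single_apply]

theorem finRotate_symm_zero (n : ℕ) : (finRotate (n+1)).symm 0 = Fin.last n := by
  rw [Equiv.symm_apply_eq, finRotate_last]

theorem finRotate_symm_succ (n : ℕ) (p : Fin n) :
    (finRotate (n+1)).symm p.succ = p.castSucc := by
  rw [Equiv.symm_apply_eq, finRotate_apply, Fin.coeSucc_eq_succ]

theorem Dom_eq_dstar_sub_cyc (g k : ℕ) (D : H g →ₗ[ℚ] T g (k+1)) :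
    Dom g k D = dstar g k D - cyc g (k+2) (dstar g k D) := by
  funext φ
  simp only [Pi.sub_apply, cyc, dstar, Dom, Function.comp_apply, finRotate_symm_zero,
    finRotate_symm_succ, ← Finset.sum_sub_distrib]
  exact Finset.sum_congr rfl fun i _ => by ring

/-- The derivation `u ↦ Σᵢ (u_{yᵢ} t(xᵢ, ·) - u_{xᵢ} t(yᵢ, ·))` determined by a tensor `t`. -/
def ofTensor (g k : ℕ) (t : T g (k+2)) : H g →ₗ[ℚ] T g (k+1) where
  toFun u ψ := ∑ i : Fin g, (u (Sum.inr i) * t (Fin.cons (Sum.inl i) ψ)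
    - u (Sum.inl i) * t (Fin.cons (Sum.inr i) ψ))
  map_add' u v := by
    funext ψ
    simp only [Pi.add_apply, ← Finset.sum_add_distrib]
    exact Finset.sum_congr rfl fun i _ => by ring
  map_smul' c u := by
    funext ψ
    simp only [Pi.smul_apply, smul_eq_mul, RingHom.id_apply, Finset.mul_sum]
    exact Finset.sum_congr rfl fun i _ => by ring

theorem ofTensor_xB (g k : ℕ) (t : T g (k+2)) (i : Fin g) (ψ : Fin (k+1) → I g) :
    ofTensor g k t (xB g i) ψ = - t (Fin.cons (Sum.inr i) ψ) := by
  simp [ofTensor, xB, Pi.single_apply]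

theorem ofTensor_yB (g k : ℕ) (t : T g (k+2)) (i : Fin g) (ψ : Fin (k+1) → I g) :
    ofTensor g k t (yB g i) ψ = t (Fin.cons (Sum.inl i) ψ) := by
  simp [ofTensor, yB, Pi.single_apply]

theorem dstar_ofTensor (g k : ℕ) (t : T g (k+2)) : dstar g k (ofTensor g k t) = t := by
  funext φ
  rw [dstar_apply]
  have hφ : Fin.cons (φ 0) (fun p => φ p.succ) = φ := Fin.cons_self_tail φ
  rcases h : φ 0 with j | j <;> rw [h] at hφ <;>
    simp [ofTensor_xB, ofTensor_yB, hφ]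

theorem ofTensor_dstar (g k : ℕ) (D : H g →ₗ[ℚ] T g (k+1)) :
    ofTensor g k (dstar g k D) = D := by
  refine (Pi.basisFun ℚ (I g)).ext fun j => ?_
  rw [Pi.basisFun_apply]
  funext ψ
  rcases j with i | i
  · change ofTensor g k (dstar g k D) (xB g i) ψ = D (xB g i) ψ
    simp [ofTensor_xB, dstar_apply]
  · change ofTensor g k (dstar g k D) (yB g i) ψ = D (yB g i) ψ
    simp [ofTensor_yB, dstar_apply]

/-- The linear isomorphism `D ↦ D*`. -/
def dstarEquiv (g k : ℕ) : (H g →ₗ[ℚ] T g (k+1)) ≃ₗ[ℚ] T g (k+2) where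
  toFun := dstar g k
  invFun := ofTensor g k
  left_inv := ofTensor_dstar g k
  right_inv := dstar_ofTensor g k
  map_add' D E := by
    funext φ
    simp only [Pi.add_apply, dstar_apply]
    rcases φ 0 with j | j <;> simp [add_comm]
  map_smul' c D := by
    funext φ
    simp only [Pi.smul_apply, dstar_apply]
    rcases φ 0 with j | j <;> simp

/-- for every `k ≥ 0`, `D ↦ D*` is a linear isomorphism
`Hom(H, H^{⊗(k+1)}) ≃ H^{⊗(k+2)}` which restricts to an isomorphism from
`𝔞_g(k) = {D : D(ω₀) = 0}` onto the `ℤ/(k+2)ℤ`-invariant part of `H^{⊗(k+2)}`. -/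
theorem stmt1 (g : ℕ) (hg : 1 ≤ g) (k : ℕ) :
    ∃ e : (H g →ₗ[ℚ] T g (k+1)) ≃ₗ[ℚ] T g (k+2),
      (∀ D, e D = dstar g k D) ∧
      (∀ D, Dom g k D = 0 ↔ cyc g (k+2) (e D) = e D) := by
  refine ⟨dstarEquiv g k, fun D => rfl, fun D => ?_⟩
  rw [Dom_eq_dstar_sub_cyc, sub_eq_zero]
  exact eq_comm
end

section
/- For g ≥ 2 there exists a surjective Lie algebra homomorphism from 𝔩_g⁺ onto the abelian Lie algebra Λ³H ⊕ ⊕_{k≥1} S^{2k+1}H. -/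
set_option maxSynthPendingDepth 2

open scoped TensorProduct DirectSum

set_option synthInstance.maxHeartbeats 1000000

/-- the free Lie algebra over `ℚ` generated by the vector space `H` -/
abbrev L (g : ℕ) := FreeLieAlgebra ℚ (I g)

/-- the canonical (linear) embedding `ι : H → L` -/
noncomputable def iotaL (g : ℕ) : H g →ₗ[ℚ] L g where
  toFun u := ∑ j : I g, u j • FreeLieAlgebra.of ℚ j
  map_add' u v := by
    simp only [Pi.add_apply, add_smul]
    exact Finset.sum_add_distrib
  map_smul' a u := by
    simp only [Pi.smul_apply, smul_eq_mul, RingHom.id_apply, mul_smul]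
    rw [Finset.smul_sum]

/-- the degree `m` homogeneous component `L(m)` of the free Lie algebra:
`L(1) = ι(H)` and `L(m+1) = span{[ι(u), ξ] : u ∈ H, ξ ∈ L(m)}`. -/
noncomputable def LS (g : ℕ) : ℕ → Submodule ℚ (L g)
  | 0 => ⊥
  | 1 => LinearMap.range (iotaL g)
  | (m+2) => Submodule.span ℚ {z : L g | ∃ u : H g, ∃ ξ ∈ LS g (m+1), z = ⁅iotaL g u, ξ⁆}

/-- the symplectic class `ω₀ = Σᵢ [ι(xᵢ), ι(yᵢ)] ∈ L(2)` -/
noncomputable def om0L (g : ℕ) : L g := ∑ i : Fin g, ⁅iotaL g (xB g i), iotaL g (yB g i)⁆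

/-- `𝔩_g⁺`: the set of derivations `d` of `L` which kill `ω₀` and have positive degree,
i.e. map `ι(H)` into the commutator ideal `[L, L]`. -/
def lplus (g : ℕ) : Set (LieDerivation ℚ (L g) (L g)) :=
  {d | d (om0L g) = 0 ∧
    ∀ u : H g, d (iotaL g u) ∈ ⁅(⊤ : LieIdeal ℚ (L g)), (⊤ : LieIdeal ℚ (L g))⁆}

/-- the `m`-th symmetric power `SᵐH` of `H`, modelled as the space of homogeneous
polynomials of degree `m` in the `2g` basis variables. -/
abbrev SymPow (g m : ℕ) := ↥(MvPolynomial.homogeneousSubmodule (I g) ℚ m)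

/-- the abelian Lie algebra `Λ³H ⊕ ⊕_{k ≥ 1} S^{2k+1}H` (as a `ℚ`-vector space) -/
abbrev TargetA (g : ℕ) := ↥(⋀[ℚ]^3 (H g)) × (⨁ k : ℕ, SymPow g (2*k+3))

/-- The underlying space of the semidirect product of a Lie algebra and one of its modules. -/
def LieModuleExt (A V : Type*) := A × V

namespace LieModuleExt

variable {A V : Type*} [LieRing A] [LieAlgebra ℚ A] [AddCommGroup V] [Module ℚ V]
  [LieRingModule A V] [LieModule ℚ A V]

instance : AddCommGroup (LieModuleExt A V) := inferInstanceAs (AddCommGroup (A × V))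

instance : Module ℚ (LieModuleExt A V) := inferInstanceAs (Module ℚ (A × V))

/-- The semidirect product bracket. -/
instance : LieRing (LieModuleExt A V) where
  bracket a b := (⁅a.1, b.1⁆, ⁅a.1, b.2⁆ - ⁅b.1, a.2⁆)
  add_lie a b c := Prod.ext (add_lie a.1 b.1 c.1) (by
    change ⁅a.1 + b.1, c.2⁆ - ⁅c.1, a.2 + b.2⁆
      = ⁅a.1, c.2⁆ - ⁅c.1, a.2⁆ + (⁅b.1, c.2⁆ - ⁅c.1, b.2⁆)
    rw [add_lie, lie_add]; abel)
  lie_add a b c := Prod.ext (lie_add a.1 b.1 c.1) (by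
    change ⁅a.1, b.2 + c.2⁆ - ⁅b.1 + c.1, a.2⁆
      = ⁅a.1, b.2⁆ - ⁅b.1, a.2⁆ + (⁅a.1, c.2⁆ - ⁅c.1, a.2⁆)
    rw [add_lie, lie_add]; abel)
  lie_self a := Prod.ext (lie_self a.1) (sub_self ⁅a.1, a.2⁆)
  leibniz_lie a b c := Prod.ext (leibniz_lie a.1 b.1 c.1) (by
    change ⁅a.1, ⁅b.1, c.2⁆ - ⁅c.1, b.2⁆⁆ - ⁅⁅b.1, c.1⁆, a.2⁆
      = ⁅⁅a.1, b.1⁆, c.2⁆ - ⁅c.1, ⁅a.1, b.2⁆ - ⁅b.1, a.2⁆⁆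
        + (⁅b.1, ⁅a.1, c.2⁆ - ⁅c.1, a.2⁆⁆ - ⁅⁅a.1, c.1⁆, b.2⁆)
    simp only [lie_sub, lie_lie]; abel)

instance : LieAlgebra ℚ (LieModuleExt A V) where
  lie_smul t a b := Prod.ext (lie_smul t a.1 b.1) (by
    change ⁅a.1, t • b.2⁆ - ⁅t • b.1, a.2⁆ = t • (⁅a.1, b.2⁆ - ⁅b.1, a.2⁆)
    rw [lie_smul, smul_lie, smul_sub])

variable (A V) in
/-- The projection of a semidirect product onto its first factor. -/
def fst : LieModuleExt A V →ₗ⁅ℚ⁆ A where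
  toFun a := a.1
  map_add' _ _ := rfl
  map_smul' _ _ := rfl
  map_lie' := rfl

end LieModuleExt

/-- A Lie derivation on a free Lie algebra can be prescribed arbitrarily on the generators. -/
theorem FreeLieAlgebra.exists_lieDerivation {X V : Type*} [AddCommGroup V] [Module ℚ V]
    [LieRingModule (FreeLieAlgebra ℚ X) V] [LieModule ℚ (FreeLieAlgebra ℚ X) V] (v : X → V) :
    ∃ D : LieDerivation ℚ (FreeLieAlgebra ℚ X) V, ∀ x, D (FreeLieAlgebra.of ℚ x) = v x := by
  let F : FreeLieAlgebra ℚ X →ₗ⁅ℚ⁆ LieModuleExt (FreeLieAlgebra ℚ X) V :=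
    FreeLieAlgebra.lift ℚ fun x => (FreeLieAlgebra.of ℚ x, v x)
  have hof (x : X) : F (FreeLieAlgebra.of ℚ x) = (FreeLieAlgebra.of ℚ x, v x) :=
    FreeLieAlgebra.lift_of_apply _ _
  have hF : (LieModuleExt.fst _ V).comp F = LieHom.id :=
    FreeLieAlgebra.hom_ext fun x => congrArg Prod.fst (hof x)
  have hfst (z : FreeLieAlgebra ℚ X) : (F z).1 = z := LieHom.congr_fun hF z
  refine ⟨⟨⟨⟨fun z => (F z).2, fun a b => ?_⟩, fun t a => ?_⟩, fun a b => ?_⟩, fun x => ?_⟩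
  · exact congrArg Prod.snd (map_add F a b)
  · exact congrArg Prod.snd (map_smul F t a)
  · change (F ⁅a, b⁆).2 = ⁅a, (F b).2⁆ - ⁅b, (F a).2⁆
    rw [LieHom.map_lie]
    change ⁅(F a).1, (F b).2⁆ - ⁅(F b).1, (F a).2⁆ = _
    rw [hfst, hfst]
  · exact congrArg Prod.snd (hof x)

open MvPolynomial

/-- The symmetric algebra of `H`, as polynomials in the basis variables. -/
abbrev SymH (g : ℕ) := MvPolynomial (I g) ℚ

section Abelianization

attribute [local instance] LieRing.ofAssociativeRing

/-- The abelianization of `L`, with values in the linear part of the symmetric algebra. -/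
noncomputable def abL (g : ℕ) : L g →ₗ[ℚ] SymH g :=
  (FreeLieAlgebra.lift ℚ (X : I g → SymH g) : L g →ₗ⁅ℚ⁆ SymH g)

@[simp] theorem abL_of {g : ℕ} (j : I g) : abL g (FreeLieAlgebra.of ℚ j) = X j :=
  FreeLieAlgebra.lift_of_apply _ _

@[simp] theorem abL_lie {g : ℕ} (a b : L g) : abL g ⁅a, b⁆ = 0 := by
  change FreeLieAlgebra.lift ℚ (X : I g → SymH g) ⁅a, b⁆ = 0
  rw [LieHom.map_lie, LieRing.of_associative_ring_bracket, mul_comm, sub_self]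

end Abelianization

/-- The free module over the symmetric algebra of `H` on the generators of `L`, on which `L` acts
through its abelianization. -/
def FoxModule (g : ℕ) := I g → SymH g

namespace FoxModule

variable {g : ℕ}

noncomputable instance : AddCommGroup (FoxModule g) :=
  inferInstanceAs (AddCommGroup (I g → SymH g))

noncomputable instance : Module ℚ (FoxModule g) := inferInstanceAs (Module ℚ (I g → SymH g))

noncomputable instance : Module (SymH g) (FoxModule g) :=
  inferInstanceAs (Module (SymH g) (I g → SymH g))

instance : IsScalarTower ℚ (SymH g) (FoxModule g) :=
  inferInstanceAs (IsScalarTower ℚ (SymH g) (I g → SymH g))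

noncomputable instance : LieRingModule (L g) (FoxModule g) where
  bracket z v := abL g z • v
  add_lie a b v := by
    change abL g (a + b) • v = abL g a • v + abL g b • v
    rw [map_add, add_smul]
  lie_add a v w := smul_add (abL g a) v w
  leibniz_lie a b v := by
    change abL g a • abL g b • v = abL g ⁅a, b⁆ • v + abL g b • abL g a • v
    rw [abL_lie, zero_smul, zero_add, smul_comm]

theorem lie_def (z : L g) (v : FoxModule g) : ⁅z, v⁆ = abL g z • v := rfl

instance : LieModule ℚ (L g) (FoxModule g) where
  smul_lie t z v := by rw [lie_def, lie_def, map_smul, smul_assoc]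
  lie_smul t z v := by rw [lie_def, lie_def, smul_comm]

end FoxModule

/-- The abelianized Fox derivatives, as a Lie derivation. -/
noncomputable def fox (g : ℕ) : LieDerivation ℚ (L g) (FoxModule g) :=
  (FreeLieAlgebra.exists_lieDerivation (V := FoxModule g) fun j =>
    (Pi.single j 1 : I g → SymH g)).choose

/-- The `i`-th abelianized Fox derivative. -/
noncomputable def foxAt {g : ℕ} (i : I g) : L g →ₗ[ℚ] SymH g :=
  (LinearMap.proj i : (I g → SymH g) →ₗ[ℚ] SymH g) ∘ₗ
    ((fox g).toLinearMap : L g →ₗ[ℚ] (I g → SymH g))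

section Fox

variable {g : ℕ}

@[simp] theorem foxAt_of (i j : I g) :
    foxAt i (FreeLieAlgebra.of ℚ j) = if i = j then 1 else 0 := by
  have h := congrFun ((FreeLieAlgebra.exists_lieDerivation (V := FoxModule g) fun j =>
    (Pi.single j 1 : I g → SymH g)).choose_spec j) i
  exact h.trans (Pi.single_apply j 1 i)

@[simp] theorem foxAt_lie (i : I g) (a b : L g) :
    foxAt i ⁅a, b⁆ = abL g a * foxAt i b - abL g b * foxAt i a :=
  congrFun ((fox g).apply_lie_eq_sub a b) i

/-- Elements of the commutator ideal. -/
noncomputable abbrev commL (g : ℕ) : LieIdeal ℚ (L g) :=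
  ⁅(⊤ : LieIdeal ℚ (L g)), (⊤ : LieIdeal ℚ (L g))⁆

theorem lie_mem_commL (a b : L g) : ⁅a, b⁆ ∈ commL g :=
  LieSubmodule.lie_mem_lie (LieSubmodule.mem_top a) (LieSubmodule.mem_top b)

theorem commL_le_ker {V : Type*} [AddCommGroup V] [Module ℚ V] (f : L g →ₗ[ℚ] V)
    (hf : ∀ a b : L g, f ⁅a, b⁆ = 0) {z : L g} (hz : z ∈ commL g) : f z = 0 := by
  have hle : (commL g).toSubmodule ≤ LinearMap.ker f := by
    rw [commL, LieSubmodule.lieIdeal_oper_eq_linear_span, Submodule.span_le]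
    rintro _ ⟨a, b, rfl⟩
    exact hf a b
  exact hle hz

theorem abL_eq_zero {z : L g} (hz : z ∈ commL g) : abL g z = 0 := commL_le_ker _ abL_lie hz

theorem lieSpan_range_of : LieSubalgebra.lieSpan ℚ (L g)
    (Set.range (FreeLieAlgebra.of ℚ : I g → L g)) = ⊤ := by
  set S := LieSubalgebra.lieSpan ℚ (L g) (Set.range (FreeLieAlgebra.of ℚ : I g → L g))
  let F : L g →ₗ⁅ℚ⁆ S := FreeLieAlgebra.lift ℚ fun j =>
    ⟨FreeLieAlgebra.of ℚ j, LieSubalgebra.subset_lieSpan ⟨j, rfl⟩⟩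
  have hF : S.incl.comp F = LieHom.id := FreeLieAlgebra.hom_ext fun j => by
    change ((F (FreeLieAlgebra.of ℚ j) : S) : L g) = FreeLieAlgebra.of ℚ j
    rw [FreeLieAlgebra.lift_of_apply]
  refine eq_top_iff.2 fun z _ => ?_
  rw [← show ((F z : S) : L g) = z from LieHom.congr_fun hF z]
  exact (F z).2

theorem L_induction {P : L g → Prop} (of : ∀ j, P (FreeLieAlgebra.of ℚ j)) (zero : P 0)
    (add : ∀ a b, P a → P b → P (a + b)) (smul : ∀ (t : ℚ) a, P a → P (t • a))
    (lie : ∀ a b, P a → P b → P ⁅a, b⁆) (z : L g) : P z := by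
  have hz : z ∈ LieSubalgebra.lieSpan ℚ (L g)
      (Set.range (FreeLieAlgebra.of ℚ : I g → L g)) := lieSpan_range_of ▸ LieSubalgebra.mem_top z
  induction hz using LieSubalgebra.lieSpan_induction with
  | mem x hx => obtain ⟨j, rfl⟩ := hx; exact of j
  | zero => exact zero
  | add x y _ _ hx hy => exact add x y hx hy
  | smul t x _ hx => exact smul t x hx
  | lie x y _ _ hx hy => exact lie x y hx hy

theorem constantCoeff_abL (z : L g) : constantCoeff (abL g z) = 0 := by
  induction z using L_induction with
  | of j => simp
  | zero => simp
  | add a b ha hb => simp [ha, hb]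
  | smul t a ha => simp [ha]
  | lie a b => simp

theorem constantCoeff_foxAt {z : L g} (hz : z ∈ commL g) (i : I g) :
    constantCoeff (foxAt i z) = 0 :=
  commL_le_ker ((lcoeff ℚ 0) ∘ₗ foxAt i) (fun a b => by
    simp [← constantCoeff_eq, constantCoeff_abL]) hz

/-- Chain rule for derivations of positive degree. -/
theorem foxAt_derivation (D : LieDerivation ℚ (L g) (L g))
    (hD : ∀ j, D (FreeLieAlgebra.of ℚ j) ∈ commL g) (z : L g) (i : I g) :
    foxAt i (D z) = ∑ j, foxAt i (D (FreeLieAlgebra.of ℚ j)) * foxAt j z := by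
  have hmem (z : L g) : D z ∈ commL g := by
    induction z using L_induction with
    | of j => exact hD j
    | zero => rw [map_zero]; exact zero_mem _
    | add a b ha hb => rw [map_add]; exact add_mem ha hb
    | smul t a ha => rw [map_smul]; exact (commL g).smul_mem t ha
    | lie a b =>
      rw [LieDerivation.apply_lie_eq_sub]
      exact sub_mem (lie_mem_commL _ _) (lie_mem_commL _ _)
  induction z using L_induction with
  | of k => simp
  | zero => simp
  | add a b ha hb => simp [ha, hb, mul_add, Finset.sum_add_distrib]
  | smul t a ha => simp [ha, Finset.smul_sum]
  | lie a b ha hb =>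
    rw [LieDerivation.apply_lie_eq_sub, map_sub, foxAt_lie, foxAt_lie, abL_eq_zero (hmem a),
      abL_eq_zero (hmem b), ha, hb, Finset.mul_sum, Finset.mul_sum]
    simp only [foxAt_lie, mul_sub, Finset.sum_sub_distrib, zero_mul, sub_zero]
    simp only [mul_left_comm]

end Fox

section Invariants

variable {g : ℕ}

/-- The coefficient of `X k` in a polynomial. -/
noncomputable def linCoeff (k : I g) : SymH g →ₗ[ℚ] ℚ :=
  lcoeff ℚ 0 ∘ₗ (pderiv k).toLinearMap

theorem linCoeff_apply (k : I g) (p : SymH g) : linCoeff k p = constantCoeff (pderiv k p) := by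
  simp [linCoeff, constantCoeff_eq]

theorem linCoeff_mul (k : I g) (p q : SymH g) :
    linCoeff k (p * q) = constantCoeff p * linCoeff k q + constantCoeff q * linCoeff k p := by
  simp [linCoeff_apply]

@[simp] theorem linCoeff_X (k i : I g) : linCoeff k (X i : SymH g) = if k = i then 1 else 0 := by
  simp only [linCoeff_apply, pderiv_X, Pi.single_apply, eq_comm]
  split_ifs <;> simp

/-- Evaluation of derivations at a fixed element. -/
noncomputable def evalDer (z : L g) : LieDerivation ℚ (L g) (L g) →ₗ[ℚ] L g where
  toFun D := D z
  map_add' _ _ := rfl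
  map_smul' _ _ := rfl

@[simp] theorem evalDer_apply (z : L g) (D : LieDerivation ℚ (L g) (L g)) :
    evalDer z D = D z := rfl

/-- The `j`-th component of a derivation seen as an element of `H ⊗ L` by symplectic duality. -/
noncomputable def flat : I g → (LieDerivation ℚ (L g) (L g) →ₗ[ℚ] L g) :=
  Sum.elim (fun i => evalDer (FreeLieAlgebra.of ℚ (Sum.inr i)))
    (fun i => -evalDer (FreeLieAlgebra.of ℚ (Sum.inl i)))

/-- The sum of the brackets of the generators with the components of an element of `H ⊗ L`. -/
noncomputable def bracketSum : (I g → L g) →ₗ[ℚ] L g :=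
  ∑ j, (LieAlgebra.ad ℚ (L g) (FreeLieAlgebra.of ℚ j)) ∘ₗ LinearMap.proj j

theorem bracketSum_apply (f : I g → L g) :
    bracketSum f = ∑ j, ⁅(FreeLieAlgebra.of ℚ j : L g), f j⁆ := by
  simp [bracketSum]

@[simp] theorem bracketSum_single (p : I g) (z : L g) :
    bracketSum (Pi.single p z) = ⁅(FreeLieAlgebra.of ℚ p : L g), z⁆ := by
  rw [bracketSum_apply, Finset.sum_eq_single p]
  · simp
  · intro j _ hj
    simp [Pi.single_eq_of_ne hj]
  · simp

theorem iotaL_single (j : I g) : iotaL g (Pi.single j 1) = FreeLieAlgebra.of ℚ j := by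
  change ∑ k, (Pi.single j 1 : H g) k • (FreeLieAlgebra.of ℚ k : L g) = _
  simp [Pi.single_apply, ite_smul]

theorem om0L_eq : om0L g =
    ∑ i, ⁅(FreeLieAlgebra.of ℚ (Sum.inl i) : L g), FreeLieAlgebra.of ℚ (Sum.inr i)⁆ := by
  simp only [om0L, xB, yB, iotaL_single]

theorem apply_om0L (D : LieDerivation ℚ (L g) (L g)) :
    D (om0L g) = bracketSum fun j => flat j D := by
  rw [om0L_eq, map_sum, bracketSum_apply, Fintype.sum_sum_type, ← Finset.sum_add_distrib]
  refine Finset.sum_congr rfl fun i _ => ?_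
  simp [flat, sub_eq_add_neg]

theorem mem_lplus_iff (D : LieDerivation ℚ (L g) (L g)) :
    D ∈ lplus g ↔ D (om0L g) = 0 ∧ ∀ j, D (FreeLieAlgebra.of ℚ j) ∈ commL g := by
  refine and_congr_right fun _ => ⟨fun h j => ?_, fun h u => ?_⟩
  · rw [← iotaL_single]
    exact h _
  · change D (∑ j, u j • FreeLieAlgebra.of ℚ j) ∈ commL g
    rw [map_sum]
    refine sum_mem fun j _ => ?_
    rw [map_smul]
    exact (commL g).smul_mem _ (h j)

/-- `lplus g` as a subspace. -/
noncomputable def lplusSubmodule (g : ℕ) : Submodule ℚ (LieDerivation ℚ (L g) (L g)) where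
  carrier := lplus g
  zero_mem' := ⟨rfl, fun _ => zero_mem (commL g)⟩
  add_mem' {a b} ha hb := ⟨by
    rw [LieDerivation.add_apply, ha.1, hb.1, add_zero], fun u => by
    rw [LieDerivation.add_apply]; exact add_mem (ha.2 u) (hb.2 u)⟩
  smul_mem' t a ha := ⟨by
    rw [LieDerivation.smul_apply, ha.1, smul_zero], fun u => by
    rw [LieDerivation.smul_apply]; exact (commL g).smul_mem t (ha.2 u)⟩

theorem exists_mem_lplus (f : I g → L g) (hf : ∀ j, f j ∈ commL g) (h0 : bracketSum f = 0) :
    ∃ D ∈ lplusSubmodule g, ∀ j, flat j D = f j := by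
  obtain ⟨D, hD⟩ := FreeLieAlgebra.exists_lieDerivation (V := L g)
    (Sum.elim (fun i => -f (Sum.inr i)) (fun i => f (Sum.inl i)))
  have hflat (j : I g) : flat j D = f j := by
    rcases j with i | i <;> simp [flat, hD]
  refine ⟨D, (mem_lplus_iff D).2 ⟨?_, fun j => ?_⟩, hflat⟩
  · simp only [apply_om0L, hflat, h0]
  · rw [hD]
    rcases j with i | i
    · exact neg_mem (hf _)
    · exact hf _

/-- The abelianized divergence of a derivation, which is Morita's trace up to scalars. -/
noncomputable def trace (g : ℕ) : LieDerivation ℚ (L g) (L g) →ₗ[ℚ] SymH g :=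
  ∑ j, foxAt j ∘ₗ evalDer (FreeLieAlgebra.of ℚ j)

theorem trace_apply (D : LieDerivation ℚ (L g) (L g)) :
    trace g D = ∑ j, foxAt j (D (FreeLieAlgebra.of ℚ j)) := by
  simp [trace]

/-- The sign of a symplectic basis vector: `1` for the `x`'s and `-1` for the `y`'s. -/
noncomputable def sgn : I g → SymH g := Sum.elim (fun _ => 1) (fun _ => -1)

theorem trace_eq (D : LieDerivation ℚ (L g) (L g)) :
    trace g D = ∑ j, sgn j * foxAt j.swap (flat j D) := by
  rw [trace_apply, Fintype.sum_sum_type, Fintype.sum_sum_type, add_comm]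
  simp [sgn, flat]

/-- The wedge product of three basis vectors. -/
noncomputable def wedge (i j k : I g) : ⋀[ℚ]^3 (H g) :=
  exteriorPower.ιMulti ℚ 3 ![Pi.single i 1, Pi.single j 1, Pi.single k 1]

theorem wedge_swap_left (i j k : I g) : wedge j i k = -wedge i j k := by
  rw [wedge, wedge, ← AlternatingMap.map_swap _ _ (show (0 : Fin 3) ≠ 1 by decide)]
  congr 1
  ext m : 1
  fin_cases m <;> rfl

theorem wedge_swap_right (i j k : I g) : wedge i k j = -wedge i j k := by
  rw [wedge, wedge, ← AlternatingMap.map_swap _ _ (show (1 : Fin 3) ≠ 2 by decide)]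
  congr 1
  ext m : 1
  fin_cases m <;> rfl

theorem span_wedge : Submodule.span ℚ {w : ⋀[ℚ]^3 (H g) | ∃ i j k, w = wedge i j k} = ⊤ := by
  rw [eq_top_iff, ← exteriorPower.ιMulti_span_of_span ℚ 3 (H g) (Pi.basisFun ℚ (I g)).span_eq]
  refine Submodule.span_mono ?_
  rintro _ ⟨a, ha, rfl⟩
  have h (m : Fin 3) : ∃ i : I g, Pi.single i 1 = a m := by
    obtain ⟨i, hi⟩ := ha ⟨m, rfl⟩
    exact ⟨i, by rw [← hi, Pi.basisFun_apply]⟩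
  choose s hs using h
  refine ⟨s 0, s 1, s 2, ?_⟩
  rw [wedge]
  congr 1
  ext m : 1
  fin_cases m <;> simp [hs]

/-- The degree one part of a derivation, projected to the third exterior power of `H`. -/
noncomputable def johnson (g : ℕ) : LieDerivation ℚ (L g) (L g) →ₗ[ℚ] ⋀[ℚ]^3 (H g) :=
  ∑ j, ∑ k, ∑ i, LinearMap.toSpanSingleton ℚ _ (wedge j k i) ∘ₗ linCoeff k ∘ₗ foxAt i ∘ₗ flat j

theorem johnson_apply (D : LieDerivation ℚ (L g) (L g)) : johnson g D =
    ∑ j, ∑ k, ∑ i, linCoeff k (foxAt i (flat j D)) • wedge j k i := by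
  simp [johnson]

theorem foxAt_commutator {D₁ D₂ : LieDerivation ℚ (L g) (L g)} (h₁ : D₁ ∈ lplus g)
    (h₂ : D₂ ∈ lplus g) (i j : I g) : foxAt i (⁅D₁, D₂⁆ (FreeLieAlgebra.of ℚ j)) =
      ∑ k, foxAt i (D₁ (FreeLieAlgebra.of ℚ k)) * foxAt k (D₂ (FreeLieAlgebra.of ℚ j))
      - ∑ k, foxAt i (D₂ (FreeLieAlgebra.of ℚ k)) * foxAt k (D₁ (FreeLieAlgebra.of ℚ j)) := by
  rw [LieDerivation.commutator_apply, map_sub,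
    foxAt_derivation D₁ ((mem_lplus_iff _).1 h₁).2, foxAt_derivation D₂ ((mem_lplus_iff _).1 h₂).2]

theorem trace_commutator {D₁ D₂ : LieDerivation ℚ (L g) (L g)} (h₁ : D₁ ∈ lplus g)
    (h₂ : D₂ ∈ lplus g) : trace g ⁅D₁, D₂⁆ = 0 := by
  simp only [trace_apply, foxAt_commutator h₁ h₂, Finset.sum_sub_distrib]
  rw [sub_eq_zero, Finset.sum_comm]
  simp only [mul_comm]

theorem johnson_commutator {D₁ D₂ : LieDerivation ℚ (L g) (L g)} (h₁ : D₁ ∈ lplus g)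
    (h₂ : D₂ ∈ lplus g) : johnson g ⁅D₁, D₂⁆ = 0 := by
  have h (i j k : I g) : linCoeff k (foxAt i (⁅D₁, D₂⁆ (FreeLieAlgebra.of ℚ j))) = 0 := by
    rw [foxAt_commutator h₁ h₂]
    simp [linCoeff_mul,
      constantCoeff_foxAt (((mem_lplus_iff _).1 h₁).2 _),
      constantCoeff_foxAt (((mem_lplus_iff _).1 h₂).2 _)]
  have h' (i j k : I g) : linCoeff k (foxAt i (flat j ⁅D₁, D₂⁆)) = 0 := by
    rcases j with j | j
    · exact h i (Sum.inr j) k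
    · change linCoeff k (foxAt i (-⁅D₁, D₂⁆ (FreeLieAlgebra.of ℚ (Sum.inl j)))) = 0
      rw [map_neg, map_neg, h, neg_zero]
  simp [johnson_apply, h']

theorem johnson_eq_of_flat {D : LieDerivation ℚ (L g) (L g)} {a b c : I g}
    (h : ∀ j, flat j D =
      Pi.single (M := fun _ => L g) a ⁅FreeLieAlgebra.of ℚ b, FreeLieAlgebra.of ℚ c⁆ j
      + Pi.single (M := fun _ => L g) b ⁅FreeLieAlgebra.of ℚ c, FreeLieAlgebra.of ℚ a⁆ j
      + Pi.single (M := fun _ => L g) c ⁅FreeLieAlgebra.of ℚ a, FreeLieAlgebra.of ℚ b⁆ j) :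
    johnson g D = (6 : ℚ) • wedge a b c := by
  have hs (p : I g) (q r i k : I g) (j : I g) : linCoeff k (foxAt i (Pi.single (M := fun _ => L g) p
      ⁅FreeLieAlgebra.of ℚ q, FreeLieAlgebra.of ℚ r⁆ j)) =
      (if j = p then 1 else 0) * ((if k = q then 1 else 0) * (if i = r then 1 else 0))
      - (if j = p then 1 else 0) * ((if k = r then 1 else 0) * (if i = q then 1 else 0)) := by
    rw [Pi.single_apply]
    split_ifs <;> simp_all
  have hw (p q r : I g) : ∑ j, ∑ k, ∑ i, ((if j = p then (1 : ℚ) else 0) *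
      ((if k = q then 1 else 0) * (if i = r then 1 else 0))) • wedge j k i = wedge p q r := by
    simp [ite_smul]
  simp only [johnson_apply, h, map_add, hs, add_smul, sub_smul, Finset.sum_add_distrib,
    Finset.sum_sub_distrib, hw]
  rw [wedge_swap_right c a b, wedge_swap_left a c b, wedge_swap_right b a c,
    wedge_swap_left a b c, wedge_swap_right a b c]
  module

theorem map_johnson_lplus : (lplusSubmodule g).map (johnson g) = ⊤ := by
  rw [eq_top_iff, ← span_wedge, Submodule.span_le]
  rintro _ ⟨a, b, c, rfl⟩
  obtain ⟨D, hD, h⟩ := exists_mem_lplus (Pi.single a ⁅FreeLieAlgebra.of ℚ b, FreeLieAlgebra.of ℚ c⁆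
      + Pi.single b ⁅FreeLieAlgebra.of ℚ c, FreeLieAlgebra.of ℚ a⁆
      + Pi.single c ⁅FreeLieAlgebra.of ℚ a, FreeLieAlgebra.of ℚ b⁆ : I g → L g) (fun j => by
        simp only [Pi.add_apply, Pi.single_apply]
        refine add_mem (add_mem ?_ ?_) ?_ <;> split_ifs <;>
          first | exact lie_mem_commL _ _ | exact zero_mem _) (by
        simp only [map_add, bracketSum_single]
        exact lie_jacobi _ _ _)
  refine ⟨(6⁻¹ : ℚ) • D, Submodule.smul_mem _ _ hD, ?_⟩
  rw [map_smul, johnson_eq_of_flat h, smul_smul]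
  norm_num

end Invariants

section Trees

variable {g : ℕ}

/-- The right-normed bracket of the generators in `cs`, followed by `⁅c, b⁆`. -/
noncomputable def word (cs : List (I g)) (c b : I g) : L g :=
  cs.foldr (fun p w => ⁅(FreeLieAlgebra.of ℚ p : L g), w⁆)
    ⁅FreeLieAlgebra.of ℚ c, FreeLieAlgebra.of ℚ b⁆

@[simp] theorem word_nil (c b : I g) :
    word [] c b = ⁅(FreeLieAlgebra.of ℚ c : L g), FreeLieAlgebra.of ℚ b⁆ := rfl

@[simp] theorem word_cons (p : I g) (cs : List (I g)) (c b : I g) :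
    word (p :: cs) c b = ⁅(FreeLieAlgebra.of ℚ p : L g), word cs c b⁆ := rfl

theorem word_mem_commL (cs : List (I g)) (c b : I g) : word cs c b ∈ commL g := by
  cases cs <;> exact lie_mem_commL _ _

theorem foxAt_word (cs : List (I g)) (c b i : I g) : foxAt i (word cs c b) =
    (cs.map X).prod * ((if i = b then X c else 0) - (if i = c then X b else 0)) := by
  induction cs with
  | nil => simp
  | cons p cs ih =>
    rw [word_cons, foxAt_lie, abL_eq_zero (word_mem_commL cs c b), ih]
    simp [mul_assoc]

/-- The bracket of a commutator with a word is a sum of brackets with generators, and the second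
factors have explicit Fox derivatives. -/
theorem exists_bracketSum_eq_lie_word (cs : List (I g)) (c b : I g) (A : L g) (hA : A ∈ commL g) :
    ∃ F : I g → L g, (∀ j, F j ∈ commL g) ∧ bracketSum F = ⁅A, word cs c b⁆ ∧
      ∀ i j, foxAt i (F j) = (-1) ^ cs.length * (cs.map X).prod *
        (((if j = b then X c else 0) - (if j = c then X b else 0)) * foxAt i A) := by
  induction cs generalizing A with
  | nil =>
    refine ⟨Pi.single c ⁅A, FreeLieAlgebra.of ℚ b⁆ - Pi.single b ⁅A, FreeLieAlgebra.of ℚ c⁆,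
      fun j => ?_, ?_, fun i j => ?_⟩
    · simp only [Pi.sub_apply, Pi.single_apply]
      refine sub_mem ?_ ?_ <;> split_ifs <;> first | exact lie_mem_commL _ _ | exact zero_mem _
    · rw [map_sub, bracketSum_single, bracketSum_single, word_nil, leibniz_lie A,
        ← lie_skew ⁅A, _⁆ (FreeLieAlgebra.of ℚ b : L g)]
      abel
    · simp only [Pi.sub_apply, Pi.single_apply, map_sub, List.length_nil, List.map_nil,
        List.prod_nil]
      split_ifs <;> (simp [abL_eq_zero hA]; try ring)
  | cons p cs ih =>
    obtain ⟨F, hF, hsum, hfox⟩ := ih ⁅A, FreeLieAlgebra.of ℚ p⁆ (lie_mem_commL _ _)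
    refine ⟨F + Pi.single p ⁅A, word cs c b⁆, fun j => ?_, ?_, fun i j => ?_⟩
    · simp only [Pi.add_apply, Pi.single_apply]
      refine add_mem (hF j) ?_
      split_ifs <;> first | exact lie_mem_commL _ _ | exact zero_mem _
    · rw [map_add, bracketSum_single, hsum, word_cons, leibniz_lie A]
    · have h0 : foxAt i (Pi.single (M := fun _ => L g) p ⁅A, word cs c b⁆ j) = 0 := by
        rw [Pi.single_apply]
        split_ifs <;> simp [abL_eq_zero hA, abL_eq_zero (word_mem_commL cs c b)]
      rw [Pi.add_apply, map_add, h0, hfox, foxAt_lie, abL_eq_zero hA, abL_of, List.length_cons,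
        List.map_cons, List.prod_cons]
      ring

/-- The trace of the derivation given by a caterpillar tree with ends `a`, `c` and `c'`, `b`. -/
theorem exists_tree (cs : List (I g)) (hcs : Odd cs.length) (a c c' b : I g) :
    ∃ D ∈ lplusSubmodule g, johnson g D = 0 ∧ trace g D = (cs.map X).prod *
      (sgn a * X c * ((if a.swap = b then X c' else 0) - (if a.swap = c' then X b else 0))
        - sgn c * X a * ((if c.swap = b then X c' else 0) - (if c.swap = c' then X b else 0))
        + sgn b * X c' * ((if b.swap = c then X a else 0) - (if b.swap = a then X c else 0))
        - sgn c' * X b *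
          ((if c'.swap = c then X a else 0) - (if c'.swap = a then X c else 0))) := by
  have hW := word_mem_commL cs c' b
  obtain ⟨F, hF, hsum, hfox⟩ := exists_bracketSum_eq_lie_word cs c' b
    ⁅FreeLieAlgebra.of ℚ a, FreeLieAlgebra.of ℚ c⁆ (lie_mem_commL _ _)
  obtain ⟨D, hD, hflat⟩ := exists_mem_lplus
    (Pi.single a ⁅FreeLieAlgebra.of ℚ c, word cs c' b⁆
      - Pi.single c ⁅FreeLieAlgebra.of ℚ a, word cs c' b⁆ - F) (fun j => by
        simp only [Pi.sub_apply, Pi.single_apply]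
        refine sub_mem (sub_mem ?_ ?_) (hF j) <;> split_ifs <;>
          first | exact lie_mem_commL _ _ | exact zero_mem _) (by
        rw [map_sub, map_sub, bracketSum_single, bracketSum_single, hsum,
          leibniz_lie (FreeLieAlgebra.of ℚ a : L g)]
        abel)
  have hN (i j : I g) : foxAt i (flat j D) =
      (if j = a then X c * foxAt i (word cs c' b) else 0)
      - (if j = c then X a * foxAt i (word cs c' b) else 0) - foxAt i (F j) := by
    rw [hflat]
    simp only [Pi.sub_apply, Pi.single_apply, map_sub]
    split_ifs <;> simp [abL_eq_zero hW]
  refine ⟨D, hD, ?_, ?_⟩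
  · have h0 (i j k : I g) : linCoeff k (foxAt i (flat j D)) = 0 := by
      have hA (i : I g) := constantCoeff_foxAt
        (lie_mem_commL (FreeLieAlgebra.of ℚ a : L g) (FreeLieAlgebra.of ℚ c)) i
      rw [hN, hfox, map_sub, map_sub, linCoeff_mul, linCoeff_mul, map_mul, map_mul constantCoeff,
        hA]
      have hend : constantCoeff ((if j = b then X c' else 0) - (if j = c' then X b else 0) : SymH g)
        = 0 := by split_ifs <;> simp
      rw [hend]
      split_ifs <;> simp [linCoeff_mul, constantCoeff_foxAt hW]
    simp [johnson_apply, h0]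
  · simp only [trace_eq, hN, hfox, foxAt_word, hcs.neg_one_pow, foxAt_lie, abL_of, foxAt_of]
    have key (G₁ G₂ G₃ G₄ : I g → SymH g) : ∑ j, ((if j = a then G₁ j else 0)
        - (if j = c then G₂ j else 0) + (if j = b then G₃ j else 0)
        - (if j = c' then G₄ j else 0)) = G₁ a - G₂ c + G₃ b - G₄ c' := by
      simp [Finset.sum_add_distrib]
    rw [mul_sub, mul_add, mul_sub]
    refine Eq.trans (Finset.sum_congr rfl fun j _ => ?_) (key
      (fun j => (cs.map X).prod * (sgn j * X c *
        ((if j.swap = b then X c' else 0) - (if j.swap = c' then X b else 0))))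
      (fun j => (cs.map X).prod * (sgn j * X a *
        ((if j.swap = b then X c' else 0) - (if j.swap = c' then X b else 0))))
      (fun j => (cs.map X).prod * (sgn j * X c' *
        ((if j.swap = c then X a else 0) - (if j.swap = a then X c else 0))))
      (fun j => (cs.map X).prod * (sgn j * X b *
        ((if j.swap = c then X a else 0) - (if j.swap = a then X c else 0)))))
    simp only [mul_ite, mul_one, mul_zero]
    generalize (if j.swap = b then X c' else 0 : SymH g) - (if j.swap = c' then X b else 0) = u
    generalize (if j.swap = c then X a else 0 : SymH g) - (if j.swap = a then X c else 0) = v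
    split_ifs <;> ring

end Trees

section Surjectivity

variable {g : ℕ}

/-- The handle of a symplectic basis vector. -/
def handle : I g → Fin g := Sum.elim id id

/-- The traces of the positive symplectic derivations with trivial degree one part. -/
noncomputable def traceImage (g : ℕ) : Submodule ℚ (SymH g) :=
  (lplusSubmodule g ⊓ LinearMap.ker (johnson g)).map (trace g)

theorem mul_mem_traceImage (cs : List (I g)) (hcs : Odd cs.length) (c c' : I g) (r : Fin g)
    (hc : handle c ≠ r) (hc' : handle c' ≠ r) :
    X c * (X c' * (cs.map X).prod) ∈ traceImage g := by
  obtain ⟨D₁, hD₁, hj₁, ht₁⟩ := exists_tree cs hcs (Sum.inl r) c c' (Sum.inr r)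
  obtain ⟨D₂, hD₂, hj₂, ht₂⟩ := exists_tree cs hcs (Sum.inl r) c' c (Sum.inr r)
  refine ⟨(4⁻¹ : ℚ) • (D₁ + D₂), ⟨Submodule.smul_mem _ _ (add_mem hD₁ hD₂), ?_⟩, ?_⟩
  · simp [hj₁, hj₂]
  · rw [map_smul, map_add, ht₁, ht₂, inv_smul_eq_iff₀ (by norm_num), ofNat_smul_eq_nsmul,
      nsmul_eq_mul]
    rcases c with c | c <;> rcases c' with c' | c' <;>
      simp only [handle, Sum.elim_inl, Sum.elim_inr, id, ne_eq] at hc hc' <;>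
      simp [sgn, hc, hc', Ne.symm hc, Ne.symm hc'] <;> ring_nf

theorem prod_mem_traceImage (hg : 2 ≤ g) (l : List (I g)) (hl : Odd l.length)
    (hl3 : 3 ≤ l.length) : (l.map X).prod ∈ traceImage g := by
  match l, hl, hl3 with
  | c₁ :: c₂ :: c₃ :: t, hl, _ =>
    have hodd (c : I g) : Odd (c :: t).length := by
      simp only [List.length_cons] at hl ⊢
      grind
    have : Nontrivial (Fin g) := Fin.nontrivial_iff_two_le.2 hg
    simp only [List.map_cons, List.prod_cons]
    by_cases h₁₂ : handle c₁ = handle c₂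
    · obtain ⟨r, hr⟩ := exists_ne (handle c₁)
      simpa using mul_mem_traceImage _ (hodd c₃) c₁ c₂ r hr.symm (h₁₂ ▸ hr.symm)
    by_cases h₁₃ : handle c₁ = handle c₃
    · have := mul_mem_traceImage _ (hodd c₂) c₁ c₃ (handle c₂) h₁₂ (h₁₃ ▸ h₁₂)
      simpa [mul_left_comm] using this
    by_cases h₂₃ : handle c₂ = handle c₃
    · have := mul_mem_traceImage _ (hodd c₁) c₂ c₃ (handle c₁) (Ne.symm h₁₂) (Ne.symm h₁₃)
      simpa [mul_left_comm] using this
    · simpa using mul_mem_traceImage _ (hodd c₃) c₁ c₂ (handle c₃) h₁₃ h₂₃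

theorem homogeneousSubmodule_le_traceImage (hg : 2 ≤ g) (k : ℕ) :
    homogeneousSubmodule (I g) ℚ (2 * k + 3) ≤ traceImage g := by
  rw [← homogeneousSubmodule_one_pow, homogeneousSubmodule_one_eq_span_X, Submodule.span_pow,
    Submodule.span_le]
  intro p hp
  obtain ⟨f, rfl⟩ := Set.mem_pow.1 hp
  choose s hs using fun i => (f i).2
  have := prod_mem_traceImage hg (List.ofFn s) (by simp [parity_simps]) (by simp)
  simpa [List.map_ofFn, Function.comp_def, hs] using this

/-- The inclusion of the direct sum of the odd symmetric powers into the symmetric algebra. -/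
noncomputable def oddInclusion (g : ℕ) : (⨁ k : ℕ, SymPow g (2 * k + 3)) →ₗ[ℚ] SymH g :=
  DirectSum.coeLinearMap fun k : ℕ => homogeneousSubmodule (I g) ℚ (2 * k + 3)

theorem oddInclusion_injective : Function.Injective (oddInclusion g) := by
  let _ := MvPolynomial.gradedAlgebra (σ := I g) (R := ℚ)
  have h := (DirectSum.Decomposition.isInternal
    (homogeneousSubmodule (I g) ℚ)).submodule_iSupIndep
  exact (h.comp (f := fun k : ℕ => 2 * k + 3) fun a b hab => by grind).dfinsupp_lsum_injective

theorem oddInclusion_mem_traceImage (hg : 2 ≤ g) (a : ⨁ k : ℕ, SymPow g (2 * k + 3)) :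
    oddInclusion g a ∈ traceImage g := by
  have h : LinearMap.range (oddInclusion g) ≤ traceImage g :=
    DirectSum.range_coeLinearMap.trans_le
      (iSup_le (homogeneousSubmodule_le_traceImage hg))
  exact h (LinearMap.mem_range_self _ a)

end Surjectivity

/-- for `g ≥ 2` there is a surjective homomorphism of Lie algebras from
`𝔩_g⁺` onto the abelian Lie algebra `Λ³H ⊕ ⊕_{k≥1} S^{2k+1}H`, i.e. a linear map which
kills all brackets of elements of `𝔩_g⁺` and maps `𝔩_g⁺` onto the target. -/
theorem stmt5 (g : ℕ) (hg : 2 ≤ g) :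
    ∃ φ : LieDerivation ℚ (L g) (L g) →ₗ[ℚ] TargetA g,
      (∀ d₁ ∈ lplus g, ∀ d₂ ∈ lplus g, φ ⁅d₁, d₂⁆ = 0) ∧
      (∀ a : TargetA g, ∃ d ∈ lplus g, φ d = a) := by
  obtain ⟨π, hπ⟩ := LinearMap.exists_leftInverse_of_injective (oddInclusion g)
    (LinearMap.ker_eq_bot.2 oddInclusion_injective)
  refine ⟨(johnson g).prod (π ∘ₗ trace g), fun d₁ h₁ d₂ h₂ => ?_, fun a => ?_⟩
  · refine Prod.ext (johnson_commutator h₁ h₂) ?_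
    change π (trace g ⁅d₁, d₂⁆) = 0
    rw [trace_commutator h₁ h₂, map_zero]
  · obtain ⟨d, hd, hda⟩ : a.1 ∈ (lplusSubmodule g).map (johnson g) :=
      map_johnson_lplus ▸ Submodule.mem_top
    obtain ⟨e, ⟨he, hej⟩, hea⟩ := oddInclusion_mem_traceImage hg (a.2 - π (trace g d))
    refine ⟨d + e, (lplusSubmodule g).add_mem hd he, Prod.ext ?_ ?_⟩
    · change johnson g (d + e) = a.1
      rw [map_add, hda, LinearMap.mem_ker.1 hej, add_zero]
    · change π (trace g (d + e)) = a.2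
      rw [map_add, map_add, hea, show π (oddInclusion g _) = _ from LinearMap.congr_fun hπ _,
        LinearMap.id_apply, add_sub_cancel]
end
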